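/- arXiv:1401.6828 — 3 statements merged into one kernel-verified Lean document; each statement's English description precedes it below -/
import Mathlib

section
/- Let T* > 0 be such that the maximal Riccati solution Q is defined on [0, T*] and (b/2) I_N ≤ Q₂(t) := Im Q(t) ≤ (3b/2) I_N for all t ∈ [0, T*]. Then the Taylor remainder r(t,x) := −( V(x) − V(x_c(t)) − ⟨∇V(x_c(t)), x − x_c(t)⟩ − ½⟨V''(x_c(t))(x − x_c(t)), x − x_c(t)⟩ ) ψ̃(t,x) satisfies the integrated bound ∫₀ᵗ ‖r(s,·)‖_{L²(ℝ^N)} ds ≤ C_* · ‖V^{(3)}‖∞ · t · (2/b)^{3/2} for every t ∈ [0, T*], where C_* := (1/(6 C_N)) (∫_{ℝ^N} ‖y‖⁶ e^{−‖y‖²} dy)^{1/2}. -/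
open MeasureTheory Matrix Real Set Filter
open scoped InnerProductSpace ENNReal Topology

noncomputable section

attribute [local instance] Matrix.normedAddCommGroup Matrix.normedSpace

/-- `ℝ^N` as a Euclidean space. -/
abbrev EucSp (N : ℕ) := EuclideanSpace ℝ (Fin N)

/-- A potential `V : ℝ^N → ℝ` is subquadratic if it is `C^∞` and all its derivatives of
order `≥ 2` are (globally) bounded. -/
def Subquadratic {N : ℕ} (V : EucSp N → ℝ) : Prop :=
  ContDiff ℝ (⊤ : ℕ∞) V ∧ ∀ n : ℕ, 2 ≤ n → ∃ C : ℝ, ∀ x, ‖iteratedFDeriv ℝ n V x‖ ≤ C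

/-- `E : ℝ → ℝ^N` is piecewise continuous: on each compact interval it has finitely many
discontinuities and is bounded. -/
def PiecewiseContinuous {N : ℕ} (E : ℝ → EucSp N) : Prop :=
  ∀ a b : ℝ, ∃ s : Finset ℝ,
    (∀ t ∈ Set.Icc a b, t ∉ s → ContinuousAt E t) ∧ ∃ C : ℝ, ∀ t ∈ Set.Icc a b, ‖E t‖ ≤ C

/-- The Hessian matrix `V''(x)` of `V` at `x`. -/
def hessMat {N : ℕ} (V : EucSp N → ℝ) (x : EucSp N) : Matrix (Fin N) (Fin N) ℝ :=
  Matrix.of fun i j =>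
    iteratedFDeriv ℝ 2 V x ![EuclideanSpace.single i 1, EuclideanSpace.single j 1]

/-- The operator norm of a matrix, induced by the Euclidean norm. -/
def opNorm {N : ℕ} {𝕜 : Type} [RCLike 𝕜] (M : Matrix (Fin N) (Fin N) 𝕜) : ℝ :=
  ‖LinearMap.toContinuousLinearMap (Matrix.toEuclideanLin M)‖

/-- Real part of a complex matrix. -/
def RePart {N : ℕ} (M : Matrix (Fin N) (Fin N) ℂ) : Matrix (Fin N) (Fin N) ℝ :=
  M.map Complex.re

/-- Imaginary part of a complex matrix. -/
def ImPart {N : ℕ} (M : Matrix (Fin N) (Fin N) ℂ) : Matrix (Fin N) (Fin N) ℝ :=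
  M.map Complex.im

/-- The normalization constant `C_N = (∫_{ℝ^N} e^{-‖y‖²} dy)^{1/2}`. -/
def CN (N : ℕ) : ℝ := Real.sqrt (∫ y : EucSp N, Real.exp (-‖y‖ ^ 2))

/-- The constant `C_* = (1/(6 C_N)) (∫_{ℝ^N} ‖y‖⁶ e^{-‖y‖²} dy)^{1/2}`. -/
def Cstar (N : ℕ) : ℝ :=
  (1 / (6 * CN N)) * Real.sqrt (∫ y : EucSp N, ‖y‖ ^ 6 * Real.exp (-‖y‖ ^ 2))

/-- `(x_c, v)` is a (global, `C¹`) solution of the controlled Newton equation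
`x_c'' + ∇V(x_c) = E`, `x_c(0) = x₀`, `x_c'(0) = v₀`; the second-order ODE holds at every
point where `E` is continuous. -/
def IsNewtonSol {N : ℕ} (V : EucSp N → ℝ) (E : ℝ → EucSp N) (x₀ v₀ : EucSp N)
    (x_c v : ℝ → EucSp N) : Prop :=
  x_c 0 = x₀ ∧ v 0 = v₀ ∧ Continuous v ∧ (∀ t, HasDerivAt x_c (v t) t) ∧
    ∀ t, ContinuousAt E t → HasDerivAt v (E t - gradient V (x_c t)) t

/-- Right-hand side of the Riccati equation `Q' = -(Q² + V''(x_c t))`. -/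
def riccatiF {N : ℕ} (V : EucSp N → ℝ) (x_c : ℝ → EucSp N)
    (Q : ℝ → Matrix (Fin N) (Fin N) ℂ) (t : ℝ) : Matrix (Fin N) (Fin N) ℂ :=
  -(Q t ^ 2 + (hessMat V (x_c t)).map (fun a : ℝ => (a : ℂ)))

/-- The initial datum `i b I_N`. -/
def riccatiInit (N : ℕ) (b : ℝ) : Matrix (Fin N) (Fin N) ℂ :=
  ((b : ℂ) * Complex.I) • (1 : Matrix (Fin N) (Fin N) ℂ)

/-- The bilinear form `⟨M y, y⟩ = ∑ᵢⱼ Mᵢⱼ yⱼ yᵢ` on `ℂ^N`, for a real vector `y`. -/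
def qFormC {N : ℕ} (M : Matrix (Fin N) (Fin N) ℂ) (y : EucSp N) : ℂ :=
  ∑ i, ∑ j, M i j * (y j : ℂ) * (y i : ℂ)

/-- The quadratic form `⟨M y, y⟩ = ∑ᵢⱼ Mᵢⱼ yⱼ yᵢ` on `ℝ^N`. -/
def qFormR {N : ℕ} (M : Matrix (Fin N) (Fin N) ℝ) (y : EucSp N) : ℝ :=
  ∑ i, ∑ j, M i j * y j * y i

/-- The classical action
`S(t,x) = ∫₀ᵗ (½‖x_c'(s)‖² - V(x_c(s))) ds + ⟨x_c'(t), x - x_c(t)⟩`. -/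
def action {N : ℕ} (V : EucSp N → ℝ) (x_c v : ℝ → EucSp N) (t : ℝ) (x : EucSp N) : ℝ :=
  (∫ s in (0:ℝ)..t, ((1:ℝ)/2 * ‖v s‖ ^ 2 - V (x_c s))) + ⟪v t, x - x_c t⟫_ℝ

/-- The trajectory-coherent state `ψ̃(t,x)`. -/
def psiTilde {N : ℕ} (V : EucSp N → ℝ) (E : ℝ → EucSp N) (b : ℝ)
    (x_c v : ℝ → EucSp N) (Q : ℝ → Matrix (Fin N) (Fin N) ℂ) (t : ℝ) (x : EucSp N) : ℂ :=
  ((b ^ ((N : ℝ) / 4) / CN N : ℝ) : ℂ) *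
    Complex.exp (Complex.I * (((action V x_c v t x : ℝ) : ℂ)
        + (1/2 : ℂ) * qFormC (Q t) (x - x_c t))
      + ∫ s in (0:ℝ)..t, (Complex.I * ((⟪x_c s, E s⟫_ℝ : ℝ) : ℂ) - (Q s).trace / 2))

/-- The third-order Taylor remainder of `V` at `x_c(t)`:
`V(x) - V(x_c) - ⟨∇V(x_c), x - x_c⟩ - ½⟨V''(x_c)(x - x_c), x - x_c⟩`. -/
def taylorRem3 {N : ℕ} (V : EucSp N → ℝ) (x_c : ℝ → EucSp N) (t : ℝ) (x : EucSp N) : ℝ :=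
  V x - V (x_c t) - ⟪gradient V (x_c t), x - x_c t⟫_ℝ
    - (1/2) * qFormR (hessMat V (x_c t)) (x - x_c t)

/-- The source term `r(t,x)` (Taylor remainder of `V` at `x_c(t)` multiplied by `-ψ̃`). -/
def rRem {N : ℕ} (V : EucSp N → ℝ) (E : ℝ → EucSp N) (b : ℝ)
    (x_c v : ℝ → EucSp N) (Q : ℝ → Matrix (Fin N) (Fin N) ℂ) (t : ℝ) (x : EucSp N) : ℂ :=
  -((taylorRem3 V x_c t x : ℝ) : ℂ) * psiTilde V E b x_c v Q t x

/-- Membership in the class `𝒱` of unit-norm states whose modulus is a Gaussian with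
covariance parameter `q` between `√(b/2) I_N` and `√(3b/2) I_N`. -/
def InGaussClass (N : ℕ) (b : ℝ) (φ : EucSp N → ℂ) : Prop :=
  eLpNorm φ 2 volume = 1 ∧
    ∃ (q : Matrix (Fin N) (Fin N) ℝ) (α : EucSp N), q.PosSemidef ∧
      (q - Real.sqrt (b/2) • 1).PosSemidef ∧ (Real.sqrt (3*b/2) • 1 - q).PosSemidef ∧
      ∀ᵐ x : EucSp N, ‖φ x‖ ^ 2 =
        q.det / (CN N) ^ 2 * Real.exp (-∑ i, (q.mulVec (fun j => x j - α j) i) ^ 2)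

/-- The set `𝒱` inside `L²(ℝ^N, ℂ)`. -/
def GaussSet (N : ℕ) (b : ℝ) : Set (Lp ℂ 2 (volume : Measure (EucSp N))) :=
  {φ | InGaussClass N b ⇑φ}

end

attribute [local instance] Matrix.normedAddCommGroup Matrix.normedSpace

lemma aux_qform {N : ℕ} (V : EucSp N → ℝ) (x y : EucSp N) :
    qFormR (hessMat V x) y = iteratedFDeriv ℝ 2 V x (fun _ => y) := by
  have hy : y = ∑ i, y i • EuclideanSpace.single i (1:ℝ) := by
    ext j
    simp [Finset.sum_apply, Pi.single_apply]
  have h2 : iteratedFDeriv ℝ 2 V x (fun _ => y) = iteratedFDeriv ℝ 2 V x ![y, y] := by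
    congr 1; ext i; fin_cases i <;> rfl
  have key : ∀ u w : EucSp N, iteratedFDeriv ℝ 2 V x ![u, w] = fderiv ℝ (fderiv ℝ V) x u w := by
    intro u w
    rw [iteratedFDeriv_two_apply]; rfl
  rw [h2, key]
  unfold qFormR hessMat
  simp only [Matrix.of_apply, key]
  conv_rhs => rw [hy]
  simp only [map_sum, map_smul, _root_.sum_apply, _root_.smul_apply, smul_eq_mul, Finset.mul_sum]
  rw [Finset.sum_comm]
  refine Finset.sum_congr rfl fun i _ => Finset.sum_congr rfl fun j _ => ?_
  ring

lemma aux_taylor {N : ℕ} (V : EucSp N → ℝ) (hV : ContDiff ℝ (⊤ : ℕ∞) V)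
    (M3 : ℝ) (hM3 : ∀ x, ‖iteratedFDeriv ℝ 3 V x‖ ≤ M3) (x_c : ℝ → EucSp N) (t : ℝ) (x : EucSp N) :
    |taylorRem3 V x_c t x| ≤ M3 / 6 * ‖x - x_c t‖ ^ 3 := by
  set y := x - x_c t with hy
  have hx : x = x_c t + y := by simp [hy]
  have hT := map_add_eq_sum_add_integral_iteratedFDeriv (f := V) (x := x_c t) (y := y) (n := 2)
    (fun s _ => (contDiff_infty.1 hV 3).contDiffAt)
  rw [← hx] at hT
  have hgrad : ⟪gradient V (x_c t), y⟫_ℝ = fderiv ℝ V (x_c t) y := by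
    simp [gradient]
  have hR : taylorRem3 V x_c t x = (1/2) * ∫ s in (0:ℝ)..1, (1 - s)^2 *
      iteratedFDeriv ℝ 3 V (x_c t + s • y) (fun _ => y) := by
    unfold taylorRem3
    rw [← hy, hgrad, aux_qform, hT]
    simp [Finset.sum_range_succ]
    ring
  have hb : ‖∫ s in (0:ℝ)..1, (1 - s)^2 *
      iteratedFDeriv ℝ 3 V (x_c t + s • y) (fun _ => y)‖ ≤ ∫ s in (0:ℝ)..1, (1 - s)^2 * (M3 * ‖y‖^3) := by
    apply intervalIntegral.norm_integral_le_of_norm_le zero_le_one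
    · refine Filter.Eventually.of_forall fun s _ => ?_
      rw [norm_mul, Real.norm_of_nonneg (sq_nonneg (1 - s))]
      gcongr
      refine (ContinuousMultilinearMap.le_opNorm _ _).trans ?_
      simp only [Finset.prod_const, Finset.card_univ, Fintype.card_fin]
      gcongr
      exact hM3 _
    · exact Continuous.intervalIntegrable (by fun_prop) _ _
  have hi : ∫ s in (0:ℝ)..1, (1 - s)^2 * (M3 * ‖y‖^3) = 1/3 * (M3 * ‖y‖^3) := by
    rw [intervalIntegral.integral_mul_const]
    congr 1
    have := intervalIntegral.integral_comp_sub_left (a := 0) (b := 1) (fun s : ℝ => s^2) 1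
    rw [this]; norm_num
  rw [hR, abs_mul]
  rw [hi, Real.norm_eq_abs] at hb
  norm_num at hb ⊢
  linarith

lemma aux_integrable (N : ℕ) : Integrable (fun y : EucSp N => ‖y‖ ^ 6 * Real.exp (-‖y‖ ^ 2)) := by
  have h := (GaussianFourier.integrable_cexp_neg_mul_sq_norm_add (V := EucSp N) (b := 1/2)
    (by norm_num) 0 0).norm
  refine (h.const_mul 48).mono' (by fun_prop) (Filter.Eventually.of_forall fun y => ?_)
  rw [Real.norm_of_nonneg (by positivity)]
  have h1 : ‖Complex.exp (-(1/2) * (‖y‖:ℂ) ^ 2 + 0 * (⟪(0:EucSp N), y⟫_ℝ : ℂ))‖ = Real.exp (-(‖y‖^2/2)) := by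
    rw [Complex.norm_exp]
    congr 1
    norm_cast
    simp
    norm_cast
    ring
  rw [h1]
  have h3 := Real.pow_div_factorial_le_exp (‖y‖^2/2) (by positivity) 3
  have h4 : Real.exp (-‖y‖^2) = Real.exp (-(‖y‖^2/2)) * Real.exp (-(‖y‖^2/2)) := by
    rw [← Real.exp_add]; congr 1; ring
  have h5 : Real.exp (‖y‖^2/2) * Real.exp (-(‖y‖^2/2)) = 1 := by
    rw [← Real.exp_add]; simp
  have h6 : ‖y‖^6 ≤ 48 * Real.exp (‖y‖^2/2) := by
    have : (Nat.factorial 3 : ℝ) = 6 := by norm_num [Nat.factorial]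
    rw [this, div_le_iff₀ (by norm_num)] at h3
    nlinarith [h3]
  rw [h4]
  calc _ ≤ (48 * Real.exp (‖y‖^2/2)) * (Real.exp (-(‖y‖^2/2)) * Real.exp (-(‖y‖^2/2))) := by gcongr
    _ = 48 * (Real.exp (‖y‖^2/2) * Real.exp (-(‖y‖^2/2))) * Real.exp (-(‖y‖^2/2)) := by ring
    _ = _ := by rw [h5]; ring

lemma aux_sqrt {N : ℕ} (A : Matrix (Fin N) (Fin N) ℝ) (hA : A.PosSemidef) :
    ∃ B : Matrix (Fin N) (Fin N) ℝ, A = Bᵀ * B := by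
  open scoped MatrixOrder in
  obtain ⟨B, hB⟩ := CStarAlgebra.nonneg_iff_eq_star_mul_self.mp hA.nonneg
  exact ⟨B, by rw [hB, Matrix.star_eq_conjTranspose, Matrix.conjTranspose_eq_transpose_of_trivial]⟩

lemma aux_qn {N : ℕ} (A : Matrix (Fin N) (Fin N) ℝ) (y : EucSp N) :
    qFormR A y = y.ofLp ⬝ᵥ (A *ᵥ y.ofLp) := by
  simp only [qFormR, dotProduct, mulVec, Finset.mul_sum]
  refine Finset.sum_congr rfl fun i _ => Finset.sum_congr rfl fun j _ => by ring

lemma aux_qB {N : ℕ} (B : Matrix (Fin N) (Fin N) ℝ) (y : EucSp N) :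
    qFormR (Bᵀ * B) y = ‖Matrix.toEuclideanLin B y‖ ^ 2 := by
  rw [aux_qn, ← Matrix.mulVec_mulVec, Matrix.dotProduct_mulVec, Matrix.vecMul_transpose,
    EuclideanSpace.norm_sq_eq]
  simp [dotProduct, Matrix.toLpLin_apply, sq]

lemma aux_qlow {N : ℕ} (A : Matrix (Fin N) (Fin N) ℝ) (c : ℝ) (hA : (A - c • 1).PosSemidef)
    (y : EucSp N) : c * ‖y‖ ^ 2 ≤ qFormR A y := by
  have h := hA.dotProduct_mulVec_nonneg y.ofLp
  rw [aux_qn, EuclideanSpace.norm_sq_eq]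
  simp only [Matrix.sub_mulVec, Matrix.smul_mulVec, Matrix.one_mulVec, dotProduct_sub,
    dotProduct_smul, star_trivial, smul_eq_mul] at h
  have : y.ofLp ⬝ᵥ y.ofLp = ∑ i, ‖y i‖^2 := by simp [dotProduct, sq]
  rw [← this]; linarith

lemma aux_gauss {N : ℕ} (B : Matrix (Fin N) (Fin N) ℝ) (hB : B.det ≠ 0) (a : EucSp N)
    (h : EucSp N → ℝ≥0∞) (hh : Measurable h) :
    ∫⁻ x : EucSp N, h (Matrix.toEuclideanLin B (x - a)) =
      ENNReal.ofReal |B.det|⁻¹ * ∫⁻ z : EucSp N, h z := by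
  rw [lintegral_sub_right_eq_self (fun x => h (Matrix.toEuclideanLin B x)) a]
  have hdet : LinearMap.det (Matrix.toEuclideanLin B) = B.det := by
    rw [Matrix.toEuclideanLin_eq_toLin_orthonormal, LinearMap.det_toLin]
  have hm : Measurable (Matrix.toEuclideanLin B) :=
    (LinearMap.continuous_of_finiteDimensional _).measurable
  rw [← lintegral_map hh hm,
    Measure.map_linearMap_addHaar_eq_smul_addHaar _ (by rw [hdet]; exact hB), hdet,
    lintegral_smul_measure, abs_inv]
  rfl

lemma aux_det_deriv {N : ℕ} (A : ℝ → Matrix (Fin N) (Fin N) ℝ) (A' : Matrix (Fin N) (Fin N) ℝ)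
    (t : ℝ) (s : Set ℝ) (hA : HasDerivWithinAt A A' s t) :
    HasDerivWithinAt (fun t => (A t).det) ((A t).adjugate * A').trace s t := by
  let f : ContinuousMultilinearMap ℝ (fun _ : Fin N => Fin N → ℝ) ℝ :=
    { (Matrix.detRowAlternating (n := Fin N) (R := ℝ)).toMultilinearMap with
      cont := Continuous.matrix_det continuous_id }
  have hf := (f.hasFDerivAt (x := A t)).comp_hasDerivWithinAt t hA
  have h2 : f.linearDeriv (A t) A' = ((A t).adjugate * A').trace := by
    refine (ContinuousMultilinearMap.linearDeriv_apply f (A t) A').trans ?_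
    have h3 : ∀ i, f (Function.update (A t) i (A' i)) = ∑ j, (A t).adjugate j i * A' i j := by
      intro i
      change ((A t).updateRow i (A' i)).det = _
      rw [← Matrix.cramer_transpose_apply, Matrix.cramer_eq_adjugate_mulVec,
        ← Matrix.adjugate_transpose]
      rfl
    rw [Finset.sum_congr rfl fun i _ => h3 i, Finset.sum_comm]
    rfl
  rw [h2] at hf
  exact hf

lemma aux_im_mul {N : ℕ} (M : Matrix (Fin N) (Fin N) ℂ) (H : Matrix (Fin N) (Fin N) ℝ) :
    ImPart (-(M ^ 2 + H.map (fun a : ℝ => (a : ℂ)))) =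
      -(RePart M * ImPart M + ImPart M * RePart M) := by
  ext i j
  simp only [ImPart, RePart, Matrix.map_apply, Matrix.neg_apply, Matrix.add_apply, Matrix.mul_apply,
    sq, Complex.neg_im, Complex.add_im, Complex.im_sum, Complex.mul_im, Complex.ofReal_im, add_zero,
    Finset.sum_add_distrib]

lemma aux_im_deriv {N : ℕ} (Q : ℝ → Matrix (Fin N) (Fin N) ℂ) (Q' : Matrix (Fin N) (Fin N) ℂ)
    (s : Set ℝ) (t : ℝ) (h : HasDerivWithinAt Q Q' s t) :
    HasDerivWithinAt (fun t => ImPart (Q t)) (ImPart Q') s t := by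
  refine hasDerivWithinAt_pi.2 fun i => hasDerivWithinAt_pi.2 fun j => ?_
  have h1 : HasDerivWithinAt (fun t => Q t i j) (Q' i j) s t :=
    hasDerivWithinAt_pi.1 (hasDerivWithinAt_pi.1 h i) j
  exact (Complex.imCLM.hasFDerivAt (x := Q t i j)).comp_hasDerivWithinAt t h1

lemma aux_log {N : ℕ} (V : EucSp N → ℝ) (b : ℝ) (hb : 0 < b) (x_c : ℝ → EucSp N)
    (Tstar : ℝ) (Q : ℝ → Matrix (Fin N) (Fin N) ℂ)
    (hQ0 : Q 0 = riccatiInit N b)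
    (hQ : ∀ t ∈ Set.Icc 0 Tstar, HasDerivWithinAt Q (riccatiF V x_c Q t) (Set.Ici 0) t)
    (hdet : ∀ t ∈ Set.Icc 0 Tstar, 0 < (ImPart (Q t)).det)
    (hc : ContinuousOn (fun t => (Q t).trace) (Set.Icc 0 Tstar))
    (t : ℝ) (ht : t ∈ Set.Icc 0 Tstar) :
    ∫ s in (0:ℝ)..t, (-2 * (Q s).trace.re) =
      Real.log (ImPart (Q t)).det - N * Real.log b := by
  have hD : ∀ s ∈ Set.Icc 0 Tstar, HasDerivWithinAt (fun s => (ImPart (Q s)).det)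
      (-2 * (Q s).trace.re * (ImPart (Q s)).det) (Set.Ici 0) s := by
    intro s hs
    have h := aux_det_deriv _ _ _ _ (aux_im_deriv _ _ _ _ (hQ s hs))
    convert h using 1
    rw [riccatiF, aux_im_mul]
    have htr : (Q s).trace.re = (RePart (Q s)).trace := by
      simp [Matrix.trace, RePart]
    rw [htr, mul_neg, Matrix.trace_neg, mul_add, Matrix.trace_add, ← mul_assoc, ← mul_assoc,
      Matrix.adjugate_mul, Matrix.trace_mul_comm _ (ImPart (Q s)), ← mul_assoc,
      Matrix.mul_adjugate]
    simp only [Matrix.smul_mul, one_mul, Matrix.trace_smul, smul_eq_mul]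
    ring
  have hL : ∀ s ∈ Set.Icc 0 Tstar, HasDerivWithinAt (fun s => Real.log (ImPart (Q s)).det)
      (-2 * (Q s).trace.re) (Set.Ici 0) s := by
    intro s hs
    have h := (hD s hs).log (hdet s hs).ne'
    rwa [mul_div_cancel_right₀ _ (hdet s hs).ne'] at h
  have hsub : Set.Icc 0 t ⊆ Set.Icc 0 Tstar := Set.Icc_subset_Icc_right ht.2
  rw [intervalIntegral.integral_eq_sub_of_hasDeriv_right_of_le
    (f := fun s => Real.log (ImPart (Q s)).det) ht.1]
  · congr 1
    have : ImPart (Q 0) = b • (1 : Matrix (Fin N) (Fin N) ℝ) := by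
      ext i j
      simp [hQ0, riccatiInit, ImPart, Matrix.one_apply]
      split_ifs <;> simp
    rw [this, Matrix.det_smul]
    simp
  · exact fun s hs => (hL s (hsub hs)).continuousWithinAt.mono fun u hu => hu.1
  · exact fun s hs => (hL s (hsub ⟨hs.1.le, hs.2.le⟩)).mono fun u hu => hs.1.le.trans (le_of_lt hu)
  · apply ContinuousOn.intervalIntegrable_of_Icc ht.1
    exact ((Complex.continuous_re.comp_continuousOn (hc.mono hsub)).const_smul (-2:ℝ))

lemma aux_E {N : ℕ} (E : ℝ → EucSp N) (hE : PiecewiseContinuous E) (x_c : ℝ → EucSp N)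
    (hx : Continuous x_c) (t : ℝ) (ht : 0 ≤ t) :
    IntervalIntegrable (fun s => ⟪x_c s, E s⟫_ℝ) volume 0 t := by
  obtain ⟨F, hF, C, hC⟩ := hE 0 t
  rw [intervalIntegrable_iff_integrableOn_Icc_of_le ht]
  obtain ⟨K, hK⟩ := isCompact_Icc.exists_bound_of_continuousOn (hx.continuousOn (s := Set.Icc 0 t))
  have hms : MeasurableSet (Set.Icc 0 t \ (F : Set ℝ)) :=
    measurableSet_Icc.diff F.finite_toSet.measurableSet
  have hae : (Set.Icc 0 t \ (F : Set ℝ) : Set ℝ) =ᵐ[volume] Set.Icc 0 t :=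
    sdiff_null_ae_eq_self (F.finite_toSet.measure_zero _)
  rw [← integrableOn_congr_set_ae hae]
  have hcont : ContinuousOn (fun s => ⟪x_c s, E s⟫_ℝ) (Set.Icc 0 t \ (F : Set ℝ)) := by
    intro s hs
    exact (ContinuousAt.inner hx.continuousAt (hF s hs.1 hs.2)).continuousWithinAt
  have hfin : volume (Set.Icc 0 t \ (F : Set ℝ)) < ⊤ := by
    rw [measure_congr hae]; simp
  refine IntegrableOn.of_bound hfin (hcont.aestronglyMeasurable hms) (K * C) ?_
  · refine (ae_restrict_iff' hms).2 (Filter.Eventually.of_forall fun s hs => ?_)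
    refine (norm_inner_le_norm _ _).trans ?_
    exact mul_le_mul (hK s hs.1) (hC s hs.1) (norm_nonneg _) ((norm_nonneg _).trans (hK s hs.1))

lemma aux_qIm {N : ℕ} (M : Matrix (Fin N) (Fin N) ℂ) (y : EucSp N) :
    (qFormC M y).im = qFormR (ImPart M) y := by
  simp [qFormC, qFormR, ImPart, Complex.im_sum, Complex.mul_im]

lemma aux_psi {N : ℕ} (V : EucSp N → ℝ) (E : ℝ → EucSp N) (hE : PiecewiseContinuous E)
    (b : ℝ) (hb : 0 < b) (x_c v : ℝ → EucSp N) (hx : Continuous x_c)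
    (Tstar : ℝ) (Q : ℝ → Matrix (Fin N) (Fin N) ℂ)
    (hQ0 : Q 0 = riccatiInit N b)
    (hQ : ∀ t ∈ Set.Icc 0 Tstar, HasDerivWithinAt Q (riccatiF V x_c Q t) (Set.Ici 0) t)
    (hdet : ∀ t ∈ Set.Icc 0 Tstar, 0 < (ImPart (Q t)).det)
    (t : ℝ) (ht : t ∈ Set.Icc 0 Tstar) (x : EucSp N) :
    ‖psiTilde V E b x_c v Q t x‖ ^ 2 = Real.sqrt (ImPart (Q t)).det / CN N ^ 2 *
      Real.exp (-qFormR (ImPart (Q t)) (x - x_c t)) := by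
  have hc : ContinuousOn (fun t => (Q t).trace) (Set.Icc 0 Tstar) := by
    intro s hs
    have h1 : ContinuousWithinAt Q (Set.Icc 0 Tstar) s :=
      (hQ s hs).continuousWithinAt.mono fun u hu => hu.1
    exact (Continuous.matrix_trace continuous_id).continuousAt.comp_continuousWithinAt h1
  have hlog := aux_log V b hb x_c Tstar Q hQ0 hQ hdet hc t ht
  have hint1 := aux_E E hE x_c hx t ht.1
  have hint2 : IntervalIntegrable (fun s => (Q s).trace / 2) volume 0 t :=
    ((hc.mono (Set.Icc_subset_Icc_right ht.2)).div_const 2).intervalIntegrable_of_Icc ht.1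
  have hint : IntervalIntegrable
      (fun s => Complex.I * ((⟪x_c s, E s⟫_ℝ : ℝ) : ℂ) - (Q s).trace / 2) volume 0 t :=
    (IntervalIntegrable.const_mul (f := fun s => ((⟪x_c s, E s⟫_ℝ : ℝ) : ℂ)) ⟨hint1.1.ofReal, hint1.2.ofReal⟩ _).sub hint2
  have hre : (∫ s in (0:ℝ)..t, (Complex.I * ((⟪x_c s, E s⟫_ℝ : ℝ) : ℂ) - (Q s).trace / 2)).re =
      (1/4) * (Real.log (ImPart (Q t)).det - N * Real.log b) := by
    have h := Complex.reCLM.intervalIntegral_comp_comm hint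
    rw [Complex.reCLM_apply] at h
    rw [← h, ← hlog, ← intervalIntegral.integral_const_mul]
    congr 1
    ext s
    simp
    ring
  unfold psiTilde
  rw [norm_mul, Complex.norm_exp, Complex.norm_real, Complex.add_re, hre]
  have him : (Complex.I * (((action V x_c v t x : ℝ) : ℂ)
        + (1/2 : ℂ) * qFormC (Q t) (x - x_c t))).re = -(1/2) * qFormR (ImPart (Q t)) (x - x_c t) := by
    rw [← aux_qIm]
    simp [Complex.mul_re]
  rw [him, mul_pow, Real.norm_eq_abs, sq_abs, ← Real.exp_nat_mul, div_pow,
    Real.rpow_def_of_pos hb, ← Real.exp_nat_mul]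
  have hsq : Real.sqrt (ImPart (Q t)).det = Real.exp (Real.log (ImPart (Q t)).det / 2) := by
    rw [← Real.log_sqrt (hdet t ht).le, Real.exp_log (Real.sqrt_pos.2 (hdet t ht))]
  rw [hsq, div_mul_eq_mul_div (Real.exp _), div_mul_eq_mul_div (Real.exp _), ← Real.exp_add,
    ← Real.exp_add]
  congr 2
  push_cast
  ring

lemma aux_final {N : ℕ} (V : EucSp N → ℝ) (hV : Subquadratic V)
    (M3 : ℝ) (hM3 : ∀ x, ‖iteratedFDeriv ℝ 3 V x‖ ≤ M3)
    (E : ℝ → EucSp N) (hE : PiecewiseContinuous E) (b : ℝ) (hb : 0 < b)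
    (x_c v : ℝ → EucSp N) (hx : Continuous x_c)
    (Tstar : ℝ) (Q : ℝ → Matrix (Fin N) (Fin N) ℂ)
    (hQ0 : Q 0 = riccatiInit N b)
    (hQ : ∀ t ∈ Set.Icc 0 Tstar, HasDerivWithinAt Q (riccatiF V x_c Q t) (Set.Ici 0) t)
    (hbnd : ∀ t ∈ Set.Icc 0 Tstar, (ImPart (Q t) - (b/2) • 1).PosSemidef)
    (t : ℝ) (ht : t ∈ Set.Icc 0 Tstar) :
    (eLpNorm (rRem V E b x_c v Q t) 2 (volume : Measure (EucSp N))).toReal ≤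
        Cstar N * M3 * (2/b) ^ ((3:ℝ)/2) := by
  have hM0 : 0 ≤ M3 := (norm_nonneg _).trans (hM3 0)
  have hpd : ∀ t ∈ Set.Icc 0 Tstar, (ImPart (Q t)).PosDef := by
    intro s hs
    have h1 : ((b/2) • (1 : Matrix (Fin N) (Fin N) ℝ)).PosDef :=
      Matrix.PosDef.one.smul (by positivity)
    have := h1.add_posSemidef (hbnd s hs)
    rwa [add_sub_cancel] at this
  have hdet : ∀ t ∈ Set.Icc 0 Tstar, 0 < (ImPart (Q t)).det := fun s hs => (hpd s hs).det_pos
  obtain ⟨B, hB⟩ := aux_sqrt _ (hpd t ht).posSemidef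
  have hsd : Real.sqrt (ImPart (Q t)).det = |B.det| := by
    rw [hB, Matrix.det_mul, Matrix.det_transpose, ← sq, Real.sqrt_sq_eq_abs]
  have hBd : B.det ≠ 0 := by
    intro h
    have := Real.sqrt_pos.2 (hdet t ht)
    rw [hsd, h] at this
    simp at this
  set J := ∫ y : EucSp N, ‖y‖ ^ 6 * Real.exp (-‖y‖ ^ 2) with hJ
  have hJ0 : 0 ≤ J := integral_nonneg fun y => by positivity
  have hCN : 0 ≤ CN N := Real.sqrt_nonneg _
  set K := Cstar N * M3 * (2/b) ^ ((3:ℝ)/2) with hK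
  have hK0 : 0 ≤ K := by
    rw [hK, Cstar]; positivity
  set c := (M3/6)^2 / CN N ^ 2 * |B.det| * (2/b)^3 with hc
  have hc0 : 0 ≤ c := by rw [hc]; positivity
  have hK2 : c * |B.det|⁻¹ * J = K ^ 2 := by
    have e1 : ((2/b) ^ ((3:ℝ)/2)) ^ 2 = (2/b)^3 := by
      rw [← Real.rpow_natCast, ← Real.rpow_mul (by positivity), ← Real.rpow_natCast]
      norm_num
    have e2 : |B.det| * |B.det|⁻¹ = 1 := mul_inv_cancel₀ (abs_pos.2 hBd).ne'
    rw [hK, Cstar, mul_pow, mul_pow, mul_pow, e1, Real.sq_sqrt hJ0, hc]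
    rw [show (M3/6)^2 / CN N ^ 2 * |B.det| * (2/b)^3 * |B.det|⁻¹ * J =
      (M3/6)^2 / CN N ^ 2 * (2/b)^3 * J * (|B.det| * |B.det|⁻¹) by ring, e2]
    ring
  have hpt : ∀ x, ‖rRem V E b x_c v Q t x‖ ^ 2 ≤ c *
      (‖Matrix.toEuclideanLin B (x - x_c t)‖ ^ 6 *
        Real.exp (-‖Matrix.toEuclideanLin B (x - x_c t)‖ ^ 2)) := by
    intro x
    have hT := aux_taylor V hV.1 M3 hM3 x_c t x
    have hq : qFormR (ImPart (Q t)) (x - x_c t) = ‖Matrix.toEuclideanLin B (x - x_c t)‖ ^ 2 := by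
      rw [hB, aux_qB]
    have hl := aux_qlow _ _ (hbnd t ht) (x - x_c t)
    have hp := aux_psi V E hE b hb x_c v hx Tstar Q hQ0 hQ hdet t ht x
    rw [hq] at hl hp
    rw [hsd] at hp
    rw [rRem, norm_mul, mul_pow, hp, norm_neg, Complex.norm_real, Real.norm_eq_abs]
    set n := ‖Matrix.toEuclideanLin B (x - x_c t)‖
    set y := ‖x - x_c t‖
    have hy : y ^ 2 ≤ 2 / b * n ^ 2 := by
      rw [div_mul_eq_mul_div, le_div_iff₀ hb]; linarith
    have hy6 : y ^ 6 ≤ (2/b)^3 * n ^ 6 := by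
      calc y ^ 6 = (y^2)^3 := by ring
        _ ≤ (2 / b * n ^ 2)^3 := by gcongr
        _ = _ := by ring
    calc _ ≤ (M3 / 6 * y ^ 3) ^ 2 * (|B.det| / CN N ^ 2 * Real.exp (-n ^ 2)) := by gcongr
      _ = (M3/6)^2 * (|B.det| / CN N ^ 2 * Real.exp (-n ^ 2)) * y ^ 6 := by ring
      _ ≤ (M3/6)^2 * (|B.det| / CN N ^ 2 * Real.exp (-n ^ 2)) * ((2/b)^3 * n ^ 6) := by gcongr
      _ = _ := by rw [hc]; ring
  have hint : ∫⁻ x, ‖rRem V E b x_c v Q t x‖ₑ ^ (2:ℝ) ≤ ENNReal.ofReal K ^ (2:ℝ) := by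
    calc _ ≤ ∫⁻ x, (fun z : EucSp N => ENNReal.ofReal c *
          ENNReal.ofReal (‖z‖ ^ 6 * Real.exp (-‖z‖ ^ 2))) (Matrix.toEuclideanLin B (x - x_c t)) := by
          refine lintegral_mono fun x => ?_
          simp only
          rw [← ENNReal.ofReal_mul hc0, ← ofReal_norm, ENNReal.rpow_two,
            ← ENNReal.ofReal_pow (norm_nonneg _)]
          exact ENNReal.ofReal_le_ofReal (hpt x)
      _ = _ := by
          rw [aux_gauss B hBd (x_c t) (fun z : EucSp N => ENNReal.ofReal c *
              ENNReal.ofReal (‖z‖ ^ 6 * Real.exp (-‖z‖ ^ 2))) (by fun_prop), lintegral_const_mul _ (by fun_prop),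
            ← ofReal_integral_eq_lintegral_ofReal (aux_integrable N)
              (Filter.Eventually.of_forall fun y => by positivity), ← hJ,
            ← ENNReal.ofReal_mul hc0, ← ENNReal.ofReal_mul (by positivity), ENNReal.rpow_two,
            ← ENNReal.ofReal_pow hK0, ← hK2]
          congr 1
          ring
  refine ENNReal.toReal_le_of_le_ofReal hK0 ?_
  rw [eLpNorm_eq_lintegral_rpow_enorm_toReal (by norm_num) (by norm_num)]
  simp only [ENNReal.toReal_ofNat]
  calc _ ≤ (ENNReal.ofReal K ^ (2:ℝ)) ^ (1 / (2:ℝ)) := by gcongr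
    _ = _ := by rw [← ENNReal.rpow_mul]; norm_num


/-- Integrated bound on the source term: if on `[0, T*]` one has
`(b/2) I_N ≤ Q₂ ≤ (3b/2) I_N`, then
`∫₀ᵗ ‖r(s,·)‖_{L²} ds ≤ C_* ‖V⁽³⁾‖∞ t (2/b)^{3/2}` for every `t ∈ [0, T*]`. -/
theorem statement11 {N : ℕ} (hN : 1 ≤ N) (V : EucSp N → ℝ) (hV : Subquadratic V)
    (M3 : ℝ) (hM3 : ∀ x, ‖iteratedFDeriv ℝ 3 V x‖ ≤ M3)
    (E : ℝ → EucSp N) (hE : PiecewiseContinuous E) (b : ℝ) (hb : 0 < b)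
    (x₀ v₀ : EucSp N) (x_c v : ℝ → EucSp N) (hxc : IsNewtonSol V E x₀ v₀ x_c v)
    (Tstar : ℝ) (hTstar : 0 < Tstar) (Q : ℝ → Matrix (Fin N) (Fin N) ℂ)
    (hQ0 : Q 0 = riccatiInit N b)
    (hQ : ∀ t ∈ Set.Icc 0 Tstar, HasDerivWithinAt Q (riccatiF V x_c Q t) (Set.Ici 0) t)
    (hbnd : ∀ t ∈ Set.Icc 0 Tstar,
      (ImPart (Q t) - (b/2) • 1).PosSemidef ∧ ((3*b/2) • 1 - ImPart (Q t)).PosSemidef) :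
    ∀ t ∈ Set.Icc 0 Tstar,
      (∫ s in (0:ℝ)..t,
          (eLpNorm (rRem V E b x_c v Q s) 2 (volume : Measure (EucSp N))).toReal) ≤
        Cstar N * M3 * t * (2/b) ^ ((3:ℝ)/2) := by
  intro t ht
  have hx : Continuous x_c :=
    continuous_iff_continuousAt.2 fun s => (hxc.2.2.2.1 s).continuousAt
  have h := intervalIntegral.norm_integral_le_of_norm_le_const (a := 0) (b := t)
    (C := Cstar N * M3 * (2/b) ^ ((3:ℝ)/2))
    (f := fun s => (eLpNorm (rRem V E b x_c v Q s) 2 (volume : Measure (EucSp N))).toReal)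
    (fun s hs => by
      rw [Set.uIoc_of_le ht.1] at hs
      rw [Real.norm_of_nonneg ENNReal.toReal_nonneg]
      exact aux_final V hV M3 hM3 E hE b hb x_c v hx Tstar Q hQ0 hQ (fun s hs => (hbnd s hs).1) s
        ⟨hs.1.le, hs.2.trans ht.2⟩)
  refine (Real.le_norm_self _).trans (h.trans (le_of_eq ?_))
  rw [sub_zero, abs_of_nonneg ht.1]
  ring
end

section
/- Fix b > 0 and define 𝒱 := { φ ∈ L²(ℝ^N, ℂ) : ‖φ‖_{L²} = 1 and there exist a real symmetric positive matrix q with √(b/2) I_N ≤ q ≤ √(3b/2) I_N and α ∈ ℝ^N such that |φ(x)|² = (det q / C_N²) e^{−‖q(x−α)‖²} for a.e. x ∈ ℝ^N }. Let T* > 0 be such that the maximal Riccati solution Q is defined on [0,T*] with (b/2) I_N ≤ Q₂(t) := Im Q(t) ≤ (3b/2) I_N for all t ∈ [0,T*]. Then the trajectory-coherent state satisfies ψ̃(t,·) ∈ 𝒱 for every t ∈ [0, T*]. -/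
open MeasureTheory Matrix Real Set Filter
open scoped InnerProductSpace ENNReal Topology

noncomputable section

attribute [local instance] Matrix.normedAddCommGroup Matrix.normedSpace

end

attribute [local instance] Matrix.normedAddCommGroup Matrix.normedSpace


theorem det_deriv_aux {N : ℕ} (M : ℝ → Matrix (Fin N) (Fin N) ℝ) (M' : Matrix (Fin N) (Fin N) ℝ)
    (s : Set ℝ) (t : ℝ) (h : ∀ i j, HasDerivWithinAt (fun u => M u i j) (M' i j) s t) :
    HasDerivWithinAt (fun u => (M u).det) ((adjugate (M t) * M').trace) s t := by
  have h1 : (adjugate (M t) * M').trace = ∑ i, ((M t).updateCol i (fun k => M' k i)).det := by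
    simp only [Matrix.trace, Matrix.diag]
    refine Finset.sum_congr rfl fun i _ => ?_
    rw [← Matrix.cramer_apply, Matrix.cramer_eq_adjugate_mulVec]; rfl 
  rw [h1]
  simp only [Matrix.det_apply']
  rw [Finset.sum_comm]
  refine HasDerivWithinAt.fun_sum fun σ _ => ?_
  rw [← Finset.mul_sum]
  refine HasDerivWithinAt.const_mul _ ?_
  have := HasDerivWithinAt.fun_finsetProd (u := Finset.univ) (f := fun i u => M u (σ i) i) (f' := fun i => M' (σ i) i) (s := s) (x := t) (fun i _ => h (σ i) i)
  refine this.congr_deriv ?_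
  refine Finset.sum_congr rfl fun i _ => ?_
  rw [← Finset.mul_prod_erase _ _ (Finset.mem_univ i)]
  simp only [smul_eq_mul, Matrix.updateCol_self]
  rw [mul_comm]
  congr 1
  refine Finset.prod_congr rfl fun j hj => ?_
  rw [Matrix.updateCol_ne (Finset.ne_of_mem_erase hj)]

theorem det_deriv_comm {N : ℕ} (M A : Matrix (Fin N) (Fin N) ℝ) :
    (adjugate M * (-(A * M + M * A))).trace = -2 * A.trace * M.det := by
  rw [Matrix.mul_neg, Matrix.trace_neg, Matrix.mul_add, Matrix.trace_add, ← Matrix.mul_assoc, ← Matrix.mul_assoc,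
    Matrix.adjugate_mul, Matrix.trace_mul_comm, ← Matrix.mul_assoc, Matrix.mul_adjugate]
  simp
  ring

/-- square root with bounds -/
theorem sqrt_aux {N : ℕ} (M : Matrix (Fin N) (Fin N) ℝ) (c d : ℝ) (hc : 0 < c)
    (h1 : (M - c • 1).PosSemidef) (h2 : (d • 1 - M).PosSemidef) :
    ∃ q : Matrix (Fin N) (Fin N) ℝ, q.PosSemidef ∧ (q - √c • 1).PosSemidef ∧
      (√d • 1 - q).PosSemidef ∧ qᵀ * q = M ∧ 0 < q.det := by
  have hM : M.IsHermitian := by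
    have := h1.1.add (Matrix.isHermitian_one.smul (show IsSelfAdjoint c from rfl) : ((c • 1 : Matrix (Fin N) (Fin N) ℝ)).IsHermitian)
    simpa using this
  obtain ⟨U, hU, l, hl⟩ : ∃ U : Matrix (Fin N) (Fin N) ℝ, U * Uᵀ = 1 ∧ ∃ l : Fin N → ℝ, M = U * Matrix.diagonal l * Uᵀ := by
    refine ⟨hM.eigenvectorUnitary, ?_, hM.eigenvalues, ?_⟩
    · have := Unitary.coe_mul_star_self hM.eigenvectorUnitary
      exact this
    · exact hM.spectral_theorem
  have hU' : Uᵀ * U = 1 := mul_eq_one_comm.mp hU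
  have key : ∀ f : Fin N → ℝ, (∀ i, 0 ≤ f i) → (U * Matrix.diagonal f * Uᵀ).PosSemidef := fun f hf =>
    (Matrix.posSemidef_diagonal_iff.mpr hf).mul_mul_conjTranspose_same U
  have e : ∀ r : ℝ, (r • 1 : Matrix (Fin N) (Fin N) ℝ) = U * Matrix.diagonal (fun _ => r) * Uᵀ := by
    intro r
    rw [← Matrix.smul_one_eq_diagonal]; simp [hU]
  have es : ∀ f g : Fin N → ℝ, U * Matrix.diagonal f * Uᵀ - U * Matrix.diagonal g * Uᵀ = U * Matrix.diagonal (fun i => f i - g i) * Uᵀ := by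
    intro f g
    rw [← sub_mul, ← mul_sub, Matrix.diagonal_sub]
  have back : ∀ f : Fin N → ℝ, (U * Matrix.diagonal f * Uᵀ).PosSemidef → ∀ i, 0 ≤ f i := by
    intro f hf
    have := hf.conjTranspose_mul_mul_same U
    rw [← Matrix.posSemidef_diagonal_iff]
    convert this using 1
    change _ = Uᵀ * _ * U
    simp only [Matrix.mul_assoc, hU', Matrix.mul_one]
    rw [← Matrix.mul_assoc, hU', Matrix.one_mul]
  rw [hl, e, es] at h1 h2
  have l1 := back _ h1
  have l2 := back _ h2
  refine ⟨U * Matrix.diagonal (fun i => √(l i)) * Uᵀ, key _ fun i => by positivity, ?_, ?_, ?_, ?_⟩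
  · rw [e, es]; exact key _ fun i => sub_nonneg.2 (Real.sqrt_le_sqrt (by linarith [l1 i]))
  · rw [e, es]; exact key _ fun i => sub_nonneg.2 (Real.sqrt_le_sqrt (by linarith [l2 i]))
  · have hh : diagonal (fun i => √(l i)) * diagonal (fun i => √(l i)) = diagonal l := by
      rw [Matrix.diagonal_mul_diagonal]; congr 1; ext i; exact Real.mul_self_sqrt (by linarith [l1 i])
    rw [hl, ← hh]
    simp only [Matrix.transpose_mul, Matrix.transpose_transpose, Matrix.diagonal_transpose, Matrix.mul_assoc]
    rw [← Matrix.mul_assoc Uᵀ U, hU', Matrix.one_mul]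
  · have hd : U.det * Uᵀ.det = 1 := by rw [← Matrix.det_mul, hU, Matrix.det_one]
    rw [Matrix.det_mul, Matrix.det_mul, mul_right_comm, hd, one_mul, Matrix.det_diagonal]
    exact Finset.prod_pos fun i _ => Real.sqrt_pos.2 (by linarith [l1 i])

theorem CN_sq (N : ℕ) : 0 < CN N ∧ ∫ y : EucSp N, Real.exp (-‖y‖ ^ 2) = CN N ^ 2 := by
  have h := GaussianFourier.integral_rexp_neg_mul_sq_norm (V := EucSp N) (b := 1) one_pos
  simp only [neg_mul, one_mul] at h
  have hp : 0 < ∫ y : EucSp N, Real.exp (-‖y‖ ^ 2) := by rw [h]; positivity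
  exact ⟨Real.sqrt_pos.2 hp, (Real.sq_sqrt hp.le).symm⟩

theorem gauss_norm {N : ℕ} (φ : EucSp N → ℂ) (q : Matrix (Fin N) (Fin N) ℝ) (α : EucSp N) (hq : 0 < q.det)
    (h : ∀ x, ‖φ x‖ ^ 2 =
        q.det / (CN N) ^ 2 * Real.exp (-∑ i, (q.mulVec (fun j => x j - α j) i) ^ 2)) :
    eLpNorm φ 2 volume = 1 := by
  obtain ⟨hC, hI⟩ := CN_sq N
  have hint : Integrable (fun y : EucSp N => Real.exp (-‖y‖ ^ 2)) := by
    by_contra hn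
    rw [integral_undef hn] at hI
    have : 0 < CN N ^ 2 := by positivity
    linarith
  have hl : ∫⁻ y : EucSp N, ENNReal.ofReal (Real.exp (-‖y‖ ^ 2)) = ENNReal.ofReal (CN N ^ 2) := by
    rw [← hI, ofReal_integral_eq_lintegral_ofReal hint (ae_of_all _ fun _ => by positivity)]
  set L := Matrix.toEuclideanLin q with hL
  have hdet : LinearMap.det L = q.det := by
    simp [hL, Matrix.toEuclideanLin]
  have hx : ∀ x : EucSp N, ∑ i, (q.mulVec (fun j => x j - α j) i) ^ 2 = ‖L (x - α)‖ ^ 2 := by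
    intro x
    rw [EuclideanSpace.real_norm_sq_eq]; rfl
  rw [eLpNorm_eq_lintegral_rpow_enorm_toReal (by norm_num) (by norm_num)]
  have hpt : ∀ x, ‖φ x‖ₑ ^ (2:ℝ≥0∞).toReal = ENNReal.ofReal (q.det / (CN N) ^ 2) * ENNReal.ofReal (Real.exp (-‖L (x - α)‖ ^ 2)) := by
    intro x
    rw [← ENNReal.ofReal_mul (by positivity), ← hx, ← h x, ← ofReal_norm]
    simp [ENNReal.ofReal_pow]
  simp_rw [hpt]
  rw [lintegral_const_mul' _ _ (by simp),
    lintegral_sub_right_eq_self (fun x => ENNReal.ofReal (Real.exp (-‖L x‖ ^ 2))) α]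
  have hmap := Measure.map_linearMap_addHaar_eq_smul_addHaar (μ := (volume : Measure (EucSp N))) (f := L) (by rw [hdet]; exact hq.ne')
  have hLc : Continuous L := L.continuous_of_finiteDimensional
  have h3 : ∫⁻ x, ENNReal.ofReal (Real.exp (-‖L x‖ ^ 2)) = ENNReal.ofReal (q.det⁻¹) * ENNReal.ofReal (CN N ^ 2) := by
    rw [← lintegral_map (μ := volume) (f := fun y => ENNReal.ofReal (Real.exp (-‖y‖ ^ 2))) (g := L) (by fun_prop) hLc.measurable, hmap,
      lintegral_smul_measure, hl, hdet, abs_of_pos (by positivity)]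
    rfl
  rw [h3, ← ENNReal.ofReal_mul (by positivity), ← ENNReal.ofReal_mul (by positivity)]
  have : q.det / CN N ^ 2 * (q.det⁻¹ * CN N ^ 2) = 1 := by field_simp
  rw [this]; simp

theorem inner_intervalIntegrable {N : ℕ} (E x_c : ℝ → EucSp N) (hE : PiecewiseContinuous E)
    (hx : Continuous x_c) (t : ℝ) (ht : 0 ≤ t) :
    IntervalIntegrable (fun s => ⟪x_c s, E s⟫_ℝ) volume 0 t := by
  rw [intervalIntegrable_iff_integrableOn_Icc_of_le ht]
  obtain ⟨s, hs, C, hC⟩ := hE 0 t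
  have hm : AEStronglyMeasurable E (volume.restrict (Icc 0 t)) := by
    have h0 : (Icc 0 t \ (s : Set ℝ) : Set ℝ) =ᵐ[volume] Icc 0 t :=
      sdiff_null_ae_eq_self (s.finite_toSet.measure_zero _)
    rw [← Measure.restrict_congr_set h0]
    refine ContinuousOn.aestronglyMeasurable (fun u hu => ?_)
      (measurableSet_Icc.diff s.finite_toSet.measurableSet)
    exact (hs u hu.1 (by simpa using hu.2)).continuousWithinAt
  obtain ⟨D, hD⟩ := (isCompact_Icc (a := 0) (b := t)).exists_bound_of_continuousOn hx.continuousOn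
  refine IntegrableOn.of_bound (by simp) ?_ (D * C) ?_
  · exact hx.aestronglyMeasurable.inner hm
  · rw [ae_restrict_iff' measurableSet_Icc]
    refine ae_of_all _ fun u hu => ?_
    refine (norm_inner_le_norm _ _).trans ?_
    exact mul_le_mul (hD u hu) (hC u hu) (norm_nonneg _) ((norm_nonneg _).trans (hD u hu))

theorem im_riccati {N : ℕ} (V : EucSp N → ℝ) (x_c : ℝ → EucSp N)
    (Q : ℝ → Matrix (Fin N) (Fin N) ℂ) (t : ℝ) (i j : Fin N) :
    (riccatiF V x_c Q t i j).im =
      (-(RePart (Q t) * ImPart (Q t) + ImPart (Q t) * RePart (Q t))) i j := by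
  simp only [riccatiF, RePart, ImPart, pow_two, Matrix.neg_apply, Matrix.add_apply,
    Matrix.mul_apply, Matrix.map_apply, Complex.neg_im, Complex.add_im, Complex.im_sum,
    Complex.mul_im, Complex.ofReal_im, Finset.sum_add_distrib]
  ring

theorem det_formula {N : ℕ} (V : EucSp N → ℝ) (b : ℝ) (x_c : ℝ → EucSp N)
    (T : ℝ) (hT : 0 < T) (Q : ℝ → Matrix (Fin N) (Fin N) ℂ)
    (hQ0 : Q 0 = riccatiInit N b)
    (hQ : ∀ t ∈ Set.Icc 0 T, HasDerivWithinAt Q (riccatiF V x_c Q t) (Set.Ici 0) t) :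
    ContinuousOn Q (Icc 0 T) ∧
    ∀ t ∈ Set.Icc 0 T, (ImPart (Q t)).det =
      b ^ N * Real.exp (-2 * ∫ s in (0:ℝ)..t, ((Q s).trace).re) := by
  have hQc : ContinuousOn Q (Icc 0 T) := fun t ht =>
    (hQ t ht).continuousWithinAt.mono Icc_subset_Ici_self
  refine ⟨hQc, ?_⟩
  have hij : ∀ t ∈ Icc 0 T, ∀ i j, HasDerivWithinAt (fun u => Q u i j) (riccatiF V x_c Q t i j) (Ici 0) t := by
    intro t ht i j
    let L : Matrix (Fin N) (Fin N) ℂ →L[ℝ] ℂ :=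
      LinearMap.toContinuousLinearMap (Matrix.entryLinearMap ℝ ℂ i j)
    exact L.hasFDerivAt.comp_hasDerivWithinAt t (hQ t ht)
  have him : ∀ t ∈ Icc 0 T, ∀ i j, HasDerivWithinAt (fun u => ImPart (Q u) i j)
      ((-(RePart (Q t) * ImPart (Q t) + ImPart (Q t) * RePart (Q t))) i j) (Ici 0) t := by
    intro t ht i j
    rw [← im_riccati V x_c]
    exact Complex.imCLM.hasFDerivAt.comp_hasDerivWithinAt t (hij t ht i j)
  have hdet : ∀ t ∈ Icc 0 T, HasDerivWithinAt (fun u => (ImPart (Q u)).det)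
      (-2 * (RePart (Q t)).trace * (ImPart (Q t)).det) (Ici 0) t := by
    intro t ht
    rw [← det_deriv_comm]
    exact det_deriv_aux _ _ _ _ (him t ht)
  set g : ℝ → ℝ := fun s => ((Q s).trace).re with hg
  have hgc : ContinuousOn g (Icc 0 T) := by
    have : Continuous fun M : Matrix (Fin N) (Fin N) ℂ => (M.trace).re := by
      fun_prop
    exact this.comp_continuousOn hQc
  have hgR : ∀ t, (RePart (Q t)).trace = g t := by
    intro t; simp [hg, RePart, Matrix.trace]
  set G : ℝ → ℝ := IccExtend hT.le ((Icc 0 T).restrict g) with hG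
  have hGc : Continuous G := hgc.restrict.Icc_extend'
  have hGg : ∀ t ∈ Icc 0 T, G t = g t := fun t ht => by
    rw [hG, IccExtend_of_mem _ _ ht]; rfl
  have hI : ∀ t ∈ Icc 0 T, ∫ s in (0:ℝ)..t, g s = ∫ s in (0:ℝ)..t, G s := by
    intro t ht
    refine intervalIntegral.integral_congr fun s hs => ?_
    rw [uIcc_of_le ht.1] at hs
    exact (hGg s ⟨hs.1, hs.2.trans ht.2⟩).symm
  have hder : ∀ t, HasDerivAt (fun u => ∫ s in (0:ℝ)..u, G s) (G t) t := fun t =>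
    intervalIntegral.integral_hasDerivAt_right (hGc.intervalIntegrable _ _)
      hGc.stronglyMeasurable.stronglyMeasurableAtFilter hGc.continuousAt
  set F : ℝ → ℝ := fun u => (ImPart (Q u)).det * Real.exp (2 * ∫ s in (0:ℝ)..u, G s) with hF
  have hFd : ∀ t ∈ Icc 0 T, HasDerivWithinAt F 0 (Ici 0) t := by
    intro t ht
    have h1 := (hdet t ht).mul (((hder t).const_mul 2).exp.hasDerivWithinAt (s := Ici 0))
    refine h1.congr_deriv ?_
    rw [hgR, hGg t ht]; ring
  have hconst := constant_of_has_deriv_right_zero (f := F) (a := 0) (b := T)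
    (fun t ht => (hFd t ht).continuousWithinAt.mono Icc_subset_Ici_self)
    (fun t ht => (hFd t ⟨ht.1, ht.2.le⟩).mono (Ici_subset_Ici.2 ht.1))
  intro t ht
  have h0 : F 0 = b ^ N := by
    have : ImPart (riccatiInit N b) = b • 1 := by
      ext i j
      by_cases hij : i = j <;> simp [ImPart, riccatiInit, Matrix.one_apply, hij]
    simp [hF, hQ0, this, Matrix.det_smul]
  have h1 := hconst t ht
  rw [h0] at h1
  rw [hI t ht, ← h1, hF]
  simp only
  rw [mul_assoc, ← Real.exp_add]
  simp

theorem norm_psi {N : ℕ} (V : EucSp N → ℝ) (E : ℝ → EucSp N) (hE : PiecewiseContinuous E)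
    (b : ℝ) (hb : 0 < b) (x_c v : ℝ → EucSp N) (hx : Continuous x_c)
    (Q : ℝ → Matrix (Fin N) (Fin N) ℂ) (t : ℝ) (ht : 0 ≤ t) (hQ : ContinuousOn Q (Icc 0 t))
    (x : EucSp N) :
    ‖psiTilde V E b x_c v Q t x‖ ^ 2 = b ^ ((N : ℝ) / 2) / CN N ^ 2 *
      Real.exp (-qFormR (ImPart (Q t)) (x - x_c t) - ∫ s in (0:ℝ)..t, ((Q s).trace).re) := by
  have hgc : ContinuousOn (fun s => (Q s).trace) (Icc 0 t) := by
    have : Continuous fun M : Matrix (Fin N) (Fin N) ℂ => M.trace := by fun_prop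
    exact this.comp_continuousOn hQ
  have hint : IntervalIntegrable (fun s => Complex.I * ((⟪x_c s, E s⟫_ℝ : ℝ) : ℂ) - (Q s).trace / 2)
      volume 0 t := by
    refine IntervalIntegrable.sub ?_ ?_
    · refine IntervalIntegrable.const_mul ?_ _
      have h := inner_intervalIntegrable E x_c hE hx t ht
      exact ⟨h.1.ofReal, h.2.ofReal⟩
    · refine ContinuousOn.intervalIntegrable ?_
      rw [uIcc_of_le ht]
      exact hgc.div_const _
  have hre : (∫ s in (0:ℝ)..t, (Complex.I * ((⟪x_c s, E s⟫_ℝ : ℝ) : ℂ) - (Q s).trace / 2)).re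
      = -(1/2) * ∫ s in (0:ℝ)..t, ((Q s).trace).re := by
    have := Complex.reCLM.intervalIntegral_comp_comm hint
    simp only [Complex.reCLM_apply] at this
    rw [← this, ← intervalIntegral.integral_const_mul]
    refine intervalIntegral.integral_congr fun s _ => ?_
    simp
    ring
  have hq : (qFormC (Q t) (x - x_c t)).im = qFormR (ImPart (Q t)) (x - x_c t) := by
    simp [qFormC, qFormR, ImPart, Complex.im_sum]
  have hr : (b ^ ((N : ℝ) / 4)) ^ 2 = b ^ ((N : ℝ) / 2) := by
    rw [← Real.rpow_natCast, ← Real.rpow_mul hb.le]; congr 1; push_cast; ring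
  rw [psiTilde, norm_mul, Complex.norm_exp, mul_pow, Complex.norm_real, Real.norm_eq_abs, sq_abs,
    div_pow, hr, ← Real.exp_nat_mul]
  congr 2
  rw [Complex.add_re, hre]
  simp [hq]
  ring

/-- If on `[0, T*]` the Riccati solution satisfies
`(b/2) I_N ≤ Q₂(t) ≤ (3b/2) I_N`, then the trajectory-coherent state `ψ̃(t,·)` belongs to the
class `𝒱` of unit-norm states with Gaussian modulus whose covariance parameter `q` satisfies
`√(b/2) I_N ≤ q ≤ √(3b/2) I_N`, for every `t ∈ [0, T*]`. -/
theorem statement13 {N : ℕ} (hN : 1 ≤ N) (V : EucSp N → ℝ) (hV : Subquadratic V)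
    (E : ℝ → EucSp N) (hE : PiecewiseContinuous E) (b : ℝ) (hb : 0 < b)
    (x₀ v₀ : EucSp N) (x_c v : ℝ → EucSp N) (hxc : IsNewtonSol V E x₀ v₀ x_c v)
    (Tstar : ℝ) (hTstar : 0 < Tstar) (Q : ℝ → Matrix (Fin N) (Fin N) ℂ)
    (hQ0 : Q 0 = riccatiInit N b)
    (hQ : ∀ t ∈ Set.Icc 0 Tstar, HasDerivWithinAt Q (riccatiF V x_c Q t) (Set.Ici 0) t)
    (hbnd : ∀ t ∈ Set.Icc 0 Tstar,
      (ImPart (Q t) - (b/2) • 1).PosSemidef ∧ ((3*b/2) • 1 - ImPart (Q t)).PosSemidef) :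
    ∀ t ∈ Set.Icc 0 Tstar, InGaussClass N b (psiTilde V E b x_c v Q t) := by

  intro t ht
  have hx : Continuous x_c := continuous_iff_continuousAt.2 fun t => (hxc.2.2.2.1 t).continuousAt
  obtain ⟨hQc, hdet⟩ := det_formula V b x_c Tstar hTstar Q hQ0 hQ
  obtain ⟨q, hq, hq1, hq2, hqM, hqd⟩ :=
    sqrt_aux (ImPart (Q t)) (b/2) (3*b/2) (by positivity) (hbnd t ht).1 (hbnd t ht).2
  have hdq : q.det = b ^ ((N : ℝ) / 2) * Real.exp (-∫ s in (0:ℝ)..t, ((Q s).trace).re) := by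
    have h1 : q.det ^ 2 = b ^ N * Real.exp (-2 * ∫ s in (0:ℝ)..t, ((Q s).trace).re) := by
      rw [← hdet t ht, ← hqM, Matrix.det_mul, Matrix.det_transpose, sq]
    have h2 : (b ^ ((N : ℝ) / 2)) ^ 2 = b ^ N := by
      rw [← Real.rpow_natCast, ← Real.rpow_mul hb.le, ← Real.rpow_natCast]
      congr 1; push_cast; ring
    rw [← sq_eq_sq₀ hqd.le (by positivity), h1, mul_pow, h2, ← Real.exp_nat_mul]
    congr 2; push_cast; ring
  have hmain : ∀ x, ‖psiTilde V E b x_c v Q t x‖ ^ 2 =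
      q.det / (CN N) ^ 2 * Real.exp (-∑ i, (q.mulVec (fun j => x j - x_c t j) i) ^ 2) := by
    intro x
    rw [norm_psi V E hE b hb x_c v hx Q t ht.1 (hQc.mono (Icc_subset_Icc_right ht.2)) x, hdq]
    have hform : qFormR (ImPart (Q t)) (x - x_c t)
        = ∑ i, (q.mulVec (fun j => x j - x_c t j) i) ^ 2 := by
      set y : Fin N → ℝ := fun j => x j - x_c t j with hy
      have e1 : qFormR (ImPart (Q t)) (x - x_c t) = y ⬝ᵥ (ImPart (Q t) *ᵥ y) := by
        simp only [qFormR, dotProduct, Matrix.mulVec, Finset.mul_sum]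
        refine Finset.sum_congr rfl fun i _ => Finset.sum_congr rfl fun j _ => ?_
        simp only [hy, PiLp.sub_apply]; ring
      rw [e1, ← hqM, ← Matrix.mulVec_mulVec, Matrix.dotProduct_mulVec, Matrix.vecMul_transpose]
      simp [dotProduct, sq]
    rw [hform, sub_eq_add_neg, Real.exp_add]
    ring
  exact ⟨gauss_norm _ q (x_c t) hqd hmain, q, x_c t, hq, hq1, hq2, ae_of_all _ hmain⟩
end

section
/- Fix b > 0 and define 𝒱 := { φ ∈ L²(ℝ^N, ℂ) : ‖φ‖_{L²} = 1 and there exist a real symmetric positive matrix q with √(b/2) I_N ≤ q ≤ √(3b/2) I_N and α ∈ ℝ^N such that |φ(x)|² = (det q / C_N²) e^{−‖q(x−α)‖²} for a.e. x ∈ ℝ^N }. Then 𝒱 is a closed subset of L²(ℝ^N, ℂ) (with the L²-norm topology), and 𝒱 is a strict subset of the unit sphere 𝒮 of L²(ℝ^N, ℂ), i.e. there exists ψ_f ∈ 𝒮 with ψ_f ∉ 𝒱. -/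
open MeasureTheory Matrix Real Set Filter
open scoped InnerProductSpace ENNReal Topology

noncomputable section

attribute [local instance] Matrix.normedAddCommGroup Matrix.normedSpace

end

lemma gs_isClosed_psd (N : ℕ) :
    IsClosed {M : Matrix (Fin N) (Fin N) ℝ | M.PosSemidef} := by
  have h : {M : Matrix (Fin N) (Fin N) ℝ | M.PosSemidef} =
      {M | M.conjTranspose = M} ∩ ⋂ x : Fin N → ℝ, {M | 0 ≤ star x ⬝ᵥ (M *ᵥ x)} := by
    ext M
    simp only [mem_ofPred_eq, mem_inter_iff, mem_iInter]
    exact posSemidef_iff_dotProduct_mulVec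
  rw [h]
  refine IsClosed.inter (isClosed_eq (by fun_prop) (by fun_prop)) (isClosed_iInter fun x => ?_)
  exact isClosed_le (by fun_prop) (by fun_prop)

lemma gs_entry_bound {N : ℕ} {q : Matrix (Fin N) (Fin N) ℝ} {c : ℝ} (hq : q.PosSemidef)
    (hc : (c • 1 - q).PosSemidef) (i j : Fin N) : q i j ∈ Icc (-c) c := by
  have hd : ∀ k, q k k ≤ c := fun k => by
    have := hc.diag_nonneg (i := k)
    simpa using this
  have hs : q j i = q i j := by
    have := hq.1.apply i j
    simpa using this
  have h1 := hq.dotProduct_mulVec_nonneg (Pi.single i 1 + Pi.single j 1)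
  have h2 := hq.dotProduct_mulVec_nonneg (Pi.single i 1 - Pi.single j 1)
  simp [mulVec_add, mulVec_sub, add_dotProduct, sub_dotProduct, dotProduct_add,
    dotProduct_sub] at h1 h2
  have := hd i
  have := hd j
  constructor <;> linarith

lemma gs_coercive {N : ℕ} {q : Matrix (Fin N) (Fin N) ℝ} {s : ℝ} (hs : 0 ≤ s)
    (h : (q - s • 1).PosSemidef) (y : Fin N → ℝ) :
    s ^ 2 * ∑ i, y i ^ 2 ≤ ∑ i, (q.mulVec y i) ^ 2 := by
  have h1 := h.dotProduct_mulVec_nonneg y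
  simp only [sub_mulVec, smul_mulVec, one_mulVec, dotProduct_sub, dotProduct_smul, star_trivial,
    smul_eq_mul] at h1
  have h2 : 0 ≤ ∑ i, (q.mulVec y i - s * y i) ^ 2 := Finset.sum_nonneg fun i _ => sq_nonneg _
  have h3 : ∑ i, (q.mulVec y i - s * y i) ^ 2 =
      ∑ i, (q.mulVec y i) ^ 2 - 2 * s * (y ⬝ᵥ (q *ᵥ y)) + s ^ 2 * ∑ i, y i ^ 2 := by
    simp only [dotProduct, Finset.mul_sum, ← Finset.sum_sub_distrib, ← Finset.sum_add_distrib]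
    exact Finset.sum_congr rfl fun i _ => by ring
  have h4 : y ⬝ᵥ y = ∑ i, y i ^ 2 := by
    simp only [dotProduct, pow_two]
  rw [h4] at h1
  nlinarith [mul_nonneg hs h1]

lemma gs_closed {N : ℕ} (b : ℝ) (hb : 0 < b) : IsClosed (GaussSet N b) := by
  apply IsSeqClosed.isClosed
  intro f φ hf hlim
  have hnf : ∀ n, ‖f n‖ = 1 := fun n => by
    rw [Lp.norm_def, (hf n).1]; simp
  have hnφ : ‖φ‖ = 1 :=
    tendsto_nhds_unique hlim.norm (by simp [hnf])
  have heφ : eLpNorm φ 2 volume = 1 := by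
    rw [Lp.norm_def] at hnφ
    rwa [ENNReal.toReal_eq_one_iff] at hnφ
  choose hn1 q α hq hql hqu hae using hf
  obtain ⟨ns, hns, hns'⟩ := (tendstoInMeasure_of_tendsto_Lp hlim).exists_seq_tendsto_ae
  have hK : IsCompact (Set.univ.pi fun _ : Fin N => Set.univ.pi fun _ : Fin N =>
      Icc (-√(3*b/2)) (√(3*b/2))) :=
    isCompact_univ_pi fun _ => isCompact_univ_pi fun _ => isCompact_Icc
  obtain ⟨Q₀, -, ms, hms, hQ⟩ := IsCompact.tendsto_subseq (X := Fin N → Fin N → ℝ) hK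
    (x := fun n => q (ns n))
    (fun n => fun i _ j _ => gs_entry_bound (hq _) (hqu _) i j)
  obtain ⟨Q, hQ'⟩ : ∃ Q : Matrix (Fin N) (Fin N) ℝ,
      Tendsto (fun n => q (ns (ms n))) atTop (𝓝 Q) := ⟨Q₀, hQ⟩
  have hae' := ae_all_iff.2 hae
  have key : ∀ᵐ x : EucSp N, Tendsto (fun n => (q (ns (ms n))).det / (CN N) ^ 2 *
      Real.exp (-∑ i, ((q (ns (ms n))).mulVec (fun j => x j - α (ns (ms n)) j) i) ^ 2)) atTop
      (𝓝 (‖φ x‖ ^ 2)) := by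
    filter_upwards [hns', hae'] with x hx hx'
    have := ((hx.comp hms.tendsto_atTop).norm.pow 2)
    refine this.congr fun n => ?_
    exact hx' (ns (ms n))
  have hdet : Tendsto (fun n => (q (ns (ms n))).det) atTop
      (𝓝 Q.det) :=
    ((continuous_id.matrix_det).tendsto _).comp hQ'
  by_cases hα : Tendsto (fun n => ‖α (ns (ms n))‖) atTop atTop
  · exfalso
    have hz : ∀ᵐ x : EucSp N, φ x = 0 := by
      filter_upwards [key] with x hx
      have hexp : Tendsto (fun n => Real.exp (-∑ i, ((q (ns (ms n))).mulVec
          (fun j => x j - α (ns (ms n)) j) i) ^ 2)) atTop (𝓝 0) := by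
        apply Real.tendsto_exp_neg_atTop_nhds_zero.comp
        have h1 : Tendsto (fun n => √(b/2) ^ 2 * ‖x - α (ns (ms n))‖ ^ 2) atTop atTop := by
          refine Tendsto.const_mul_atTop (by positivity) ?_
          refine (tendsto_pow_atTop two_ne_zero).comp ?_
          refine tendsto_atTop_mono (fun n => ?_) (tendsto_atTop_add_const_right _ (-‖x‖) hα)
          have := norm_sub_norm_le (α (ns (ms n))) x
          rw [norm_sub_rev] at this
          linarith
        refine tendsto_atTop_mono (fun n => ?_) h1
        have := gs_coercive (Real.sqrt_nonneg _) (hql (ns (ms n)))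
          (fun j => x j - α (ns (ms n)) j)
        rw [EuclideanSpace.norm_sq_eq]
        simpa using this
      have h0 := (hdet.div_const (CN N ^ 2)).mul hexp
      rw [mul_zero] at h0
      have := tendsto_nhds_unique hx h0
      simpa using this
    have : eLpNorm φ 2 volume = 0 := by
      rw [eLpNorm_congr_ae (g := 0) hz]; simp
    rw [heφ] at this
    exact one_ne_zero this
  · obtain ⟨R, hR⟩ : ∃ R, ∃ᶠ n in atTop, ‖α (ns (ms n))‖ ≤ R := by
      by_contra! hcon
      apply hα
      rw [tendsto_atTop]
      intro R
      filter_upwards [hcon R] with n hn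
      exact hn.le
    obtain ⟨A, -, ks, hks, hA⟩ := tendsto_subseq_of_frequently_bounded
      (x := fun n => α (ns (ms n))) (s := Metric.closedBall 0 R) Metric.isBounded_closedBall
      (hR.mono fun n hn => by simpa using hn)
    have hQk := hQ'.comp hks.tendsto_atTop
    refine ⟨heφ, Q, A, ?_, ?_, ?_, ?_⟩
    · exact (gs_isClosed_psd N).mem_of_tendsto hQ' (Eventually.of_forall fun n => hq _)
    · exact (gs_isClosed_psd N).mem_of_tendsto (hQ'.sub_const _)
        (Eventually.of_forall fun n => hql _)
    · exact (gs_isClosed_psd N).mem_of_tendsto (hQ'.const_sub _)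
        (Eventually.of_forall fun n => hqu _)
    · filter_upwards [key] with x hx
      refine tendsto_nhds_unique (hx.comp hks.tendsto_atTop) ?_
      have hc : Continuous (fun p : Matrix (Fin N) (Fin N) ℝ × EucSp N =>
          p.1.det / (CN N) ^ 2 * Real.exp (-∑ i, (p.1.mulVec (fun j => x j - p.2 j) i) ^ 2)) := by
        have hm : Continuous (fun p : Matrix (Fin N) (Fin N) ℝ × EucSp N =>
            p.1.mulVec (fun j => x j - p.2 j)) :=
          continuous_fst.matrix_mulVec (by fun_prop)
        have hd : Continuous (fun p : Matrix (Fin N) (Fin N) ℝ × EucSp N => p.1.det) :=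
          continuous_fst.matrix_det
        refine (hd.div_const _).mul (Real.continuous_exp.comp ?_)
        refine (continuous_finsetSum _ fun i _ => ?_).neg
        exact ((continuous_apply i).comp hm).pow 2
      have hp : Tendsto (fun n => (q (ns (ms (ks n))), α (ns (ms (ks n))))) atTop (𝓝 (Q, A)) :=
        Tendsto.prodMk_nhds hQk hA
      have hfin := (hc.tendsto (Q, A)).comp hp
      exact hfin

lemma gs_strict {N : ℕ} (hN : 1 ≤ N) (b : ℝ) :
    ∃ ψf : Lp ℂ 2 (volume : Measure (EucSp N)), ‖ψf‖ = 1 ∧ ψf ∉ GaussSet N b := by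
  have : Nonempty (Fin N) := ⟨⟨0, hN⟩⟩
  set B : Set (EucSp N) := Metric.ball 0 1 with hB
  have hBf : volume B ≠ ∞ := measure_ball_lt_top.ne
  have hB0 : volume B ≠ 0 := (Metric.measure_ball_pos volume 0 one_pos).ne'
  set f := indicatorConstLp 2 (measurableSet_ball (x := (0 : EucSp N)) (ε := 1)) hBf (1 : ℂ)
    with hf
  have hfn : ‖f‖ ≠ 0 := by
    rw [hf, norm_indicatorConstLp (by simp) (by simp)]
    have : 0 < volume.real B := ENNReal.toReal_pos hB0 hBf
    have h2 : 0 < volume.real B ^ (1 / (2 : ℝ≥0∞).toReal) := Real.rpow_pos_of_pos this _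
    simpa using h2.ne'
  refine ⟨((‖f‖⁻¹ : ℝ) : ℂ) • f, ?_, ?_⟩
  · rw [norm_smul]; simp [hfn]
  rintro ⟨h1, q, α, -, -, -, hae⟩
  by_cases hc : q.det / (CN N) ^ 2 = 0
  · have hz : ((((‖f‖⁻¹ : ℝ) : ℂ) • f : Lp ℂ 2 (volume : Measure (EucSp N))) : EucSp N → ℂ)
        =ᵐ[volume] 0 := by
      filter_upwards [hae] with x hx
      rw [hc, zero_mul] at hx
      simpa using hx
    rw [eLpNorm_congr_ae hz] at h1
    simp at h1
  · have hin : ∀ᵐ x : EucSp N, x ∈ B := by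
      filter_upwards [hae, Lp.coeFn_smul ((‖f‖⁻¹ : ℝ) : ℂ) f,
        indicatorConstLp_coeFn (p := 2) (hs := measurableSet_ball (x := (0 : EucSp N)) (ε := 1))
          (hμs := hBf) (c := (1 : ℂ))] with x hx hx2 hx3
      by_contra hxB
      rw [hx2, Pi.smul_apply, hx3, indicator_of_notMem hxB] at hx
      simp only [smul_zero, norm_zero] at hx
      exact mul_ne_zero hc (Real.exp_pos _).ne' (by rw [← hx]; norm_num)
    have huniv : volume B = volume (univ : Set (EucSp N)) := by
      apply measure_congr
      filter_upwards [hin] with x hx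
      exact propext ⟨fun _ => trivial, fun _ => hx⟩
    rw [measure_univ_of_isAddLeftInvariant] at huniv
    exact hBf huniv

attribute [local instance] Matrix.normedAddCommGroup Matrix.normedSpace

/-- The class `𝒱` is a closed subset of `L²(ℝ^N, ℂ)` and a strict subset
of the unit sphere: there is a unit-norm `ψ_f ∉ 𝒱`. -/
theorem statement14 {N : ℕ} (hN : 1 ≤ N) (b : ℝ) (hb : 0 < b) :
    IsClosed (GaussSet N b) ∧
    ∃ ψf : Lp ℂ 2 (volume : Measure (EucSp N)), ‖ψf‖ = 1 ∧ ψf ∉ GaussSet N b := by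
  exact ⟨gs_closed b hb, gs_strict hN b⟩
end
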